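/- Correctness of the ISAM with a non-zero target gap (Proposition 3, ISAM case). Let S be a nonempty finite scenario set, X a nonempty set of first-stage solutions, f : X → ℝ with f(x) ≥ 0, and Q : X × S → ℝ with Q(x,s) ≥ 0. Let P ∈ [0,1), D ⊆ S, and suppose (x̃, z̃) is a master solution of MAS_D with gap P, i.e., z̃ ≥ 0, Q(x̃,s) ≤ z̃ for all s ∈ D, and f(x̃) + z̃ ≤ (1/(1−P))·OPT_D. Suppose there exist UB : S → ℝ and k ∈ D such that Q(x̃,s) ≤ UB(s) for all s ∈ S, UB(s) ≤ UB(k) for all s ∈ S, and UB(k) = Q(x̃,k). Then f(x̃) + max_{s∈S} Q(x̃,s) ≤ (1/(1−P))·OPT_S, i.e., x̃ is a solution of the two-stage robust problem with gap P. -/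

import Mathlib

open Finset

/-- Maximum of the second-stage costs over a finite scenario subset,
with the maximum over the empty set defined as `0`. -/
noncomputable def masterMax {X σ : Type*} (Q : X → σ → ℝ) (D : Finset σ) (x : X) : ℝ :=
  if h : D.Nonempty then D.sup' h (Q x) else 0

/-- Optimal value of the master problem `MAS_D`. -/
noncomputable def OPT {X σ : Type*} (f : X → ℝ) (Q : X → σ → ℝ) (D : Finset σ) : ℝ :=
  ⨅ x : X, (f x + masterMax Q D x)

/-- The maximal second-stage cost is nonnegative when all second-stage costs are. -/
lemma masterMax_nonneg {X σ : Type*} {Q : X → σ → ℝ} (hQ : ∀ x s, 0 ≤ Q x s)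
    (D : Finset σ) (x : X) : 0 ≤ masterMax Q D x := by
  unfold masterMax
  split_ifs with h
  · obtain ⟨s, hs⟩ := h
    exact (hQ x s).trans (le_sup' (Q x) hs)
  · exact le_rfl

/-- The maximal second-stage cost is monotone in the scenario set. -/
lemma masterMax_mono {X σ : Type*} {Q : X → σ → ℝ} (hQ : ∀ x s, 0 ≤ Q x s)
    {D S : Finset σ} (hDS : D ⊆ S) (x : X) : masterMax Q D x ≤ masterMax Q S x := by
  by_cases h : D.Nonempty
  · simpa only [masterMax, dif_pos h, dif_pos (h.mono hDS)] using sup'_mono (Q x) hDS h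
  · rw [masterMax, dif_neg h]
    exact masterMax_nonneg hQ S x

/-- The optimal value of the master problem is monotone in the scenario set. -/
lemma OPT_mono {X σ : Type*} {f : X → ℝ} {Q : X → σ → ℝ}
    (hf : ∀ x, 0 ≤ f x) (hQ : ∀ x s, 0 ≤ Q x s) {D S : Finset σ} (hDS : D ⊆ S) :
    OPT f Q D ≤ OPT f Q S := by
  refine ciInf_mono ⟨0, ?_⟩ fun x => add_le_add_right (masterMax_mono hQ hDS x) (f x)
  rintro _ ⟨x, rfl⟩
  exact add_nonneg (hf x) (masterMax_nonneg hQ D x)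

/-- Correctness of the ISAM with a non-zero target gap (Proposition 3, ISAM case). -/
theorem isam_correctness {X σ : Type*} [Nonempty X]
    (S : Finset σ) (hS : S.Nonempty)
    (f : X → ℝ) (Q : X → σ → ℝ)
    (hf : ∀ x, 0 ≤ f x) (hQ : ∀ x s, 0 ≤ Q x s)
    (P : ℝ) (hP0 : 0 ≤ P) (hP1 : P < 1)
    (D : Finset σ) (hD : D ⊆ S)
    (xt : X) (zt : ℝ) (hzt : 0 ≤ zt)
    (hmaster : ∀ s ∈ D, Q xt s ≤ zt)
    (hgap : f xt + zt ≤ (1 / (1 - P)) * OPT f Q D)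
    (UB : σ → ℝ) (k : σ) (hk : k ∈ D)
    (hQUB : ∀ s ∈ S, Q xt s ≤ UB s)
    (hmax : ∀ s ∈ S, UB s ≤ UB k)
    (hopt : UB k = Q xt k) :
    f xt + S.sup' hS (Q xt) ≤ (1 / (1 - P)) * OPT f Q S := by
  have hsup : S.sup' hS (Q xt) ≤ zt := sup'_le hS _ fun s hs =>
    (hQUB s hs).trans ((hmax s hs).trans (hopt.le.trans (hmaster k hk)))
  have hP : 0 ≤ 1 / (1 - P) := one_div_nonneg.mpr (sub_nonneg.mpr hP1.le)
  calc f xt + S.sup' hS (Q xt) ≤ f xt + zt := by gcongr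
    _ ≤ (1 / (1 - P)) * OPT f Q D := hgap
    _ ≤ (1 / (1 - P)) * OPT f Q S := mul_le_mul_of_nonneg_left (OPT_mono hf hQ hD) hP
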